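/- arXiv:1611.04718 — 8 statements merged into one kernel-verified Lean document; each statement's English description precedes it below -/
import Mathlib

section
/- Let E be a real Hilbert space, let P and K be bounded self-adjoint operators on E with K compact and ⟨x, P x⟩ ≥ 0 for all x, and set H := P − K. Let M be a bounded self-adjoint coercive operator on E, g ∈ E, and Δ > 0. Then the trust region problem has a solution: there exists x* ∈ E with ⟨x*, M x*⟩ ≤ Δ² such that q(x*) ≤ q(x) for every x ∈ E with ⟨x, M x⟩ ≤ Δ², where q(x) = ½⟨x, H x⟩ + ⟨g, x⟩. -/
open RealInnerProductSpace
open Filter Topology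

/-- Along an ultrafilter, a bounded family in a Hilbert space converges weakly. -/
lemma Ultrafilter.exists_tendsto_inner_of_norm_le {ι E : Type*} [NormedAddCommGroup E]
    [InnerProductSpace ℝ E] [CompleteSpace E] (F : Ultrafilter ι) {u : ι → E} {R : ℝ}
    (hu : ∀ i, ‖u i‖ ≤ R) :
    ∃ a : E, ∀ y : E, Tendsto (fun i => ⟪u i, y⟫) F (𝓝 ⟪a, y⟫) := by
  let φ : ι → WeakDual ℝ E := fun i =>
    StrongDual.toWeakDual (InnerProductSpace.toDual ℝ E (u i))
  obtain ⟨f, -, hf⟩ := (WeakDual.isCompact_closedBall (𝕜 := ℝ) (E := E) 0 R).ultrafilter_le_nhds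
    (F.map φ) (by
      refine le_principal_iff.2 (Filter.mem_map.2 (univ_mem' fun i => ?_))
      simpa [φ] using hu i)
  refine ⟨(InnerProductSpace.toDual ℝ E).symm (WeakDual.toStrongDual f), fun y => ?_⟩
  have h : Tendsto (fun i => φ i y) F (𝓝 (f y)) :=
    ((WeakDual.eval_continuous y).tendsto f).comp hf
  simpa [φ] using h

/-- The quadratic form of a positive symmetric operator is weakly lower semicontinuous. -/
lemma ContinuousLinearMap.inner_self_le_of_tendsto_inner {ι E : Type*} [NormedAddCommGroup E]
    [InnerProductSpace ℝ E] {F : Filter ι} [F.NeBot] {A : E →L[ℝ] E}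
    (hA : ∀ x y : E, ⟪A x, y⟫ = ⟪x, A y⟫) (hpos : ∀ x : E, 0 ≤ ⟪x, A x⟫)
    {u : ι → E} {a : E} (hu : ∀ y : E, Tendsto (fun i => ⟪u i, y⟫) F (𝓝 ⟪a, y⟫))
    {b : ι → ℝ} {L : ℝ} (hb : Tendsto b F (𝓝 L)) (hub : ∀ i, ⟪u i, A (u i)⟫ ≤ b i) :
    ⟪a, A a⟫ ≤ L := by
  have h : Tendsto (fun i => 2 * ⟪u i, A a⟫ - ⟪a, A a⟫) F (𝓝 (2 * ⟪a, A a⟫ - ⟪a, A a⟫)) :=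
    ((hu (A a)).const_mul 2).sub_const _
  have hle := le_of_tendsto_of_tendsto' h hb fun i => ?_
  · linarith
  · have h₁ := hpos (u i - a)
    have h₂ : ⟪a, A (u i)⟫ = ⟪u i, A a⟫ := by rw [← hA, real_inner_comm]
    simp only [map_sub, inner_sub_left, inner_sub_right] at h₁
    linarith [hub i]

/-- The quadratic form of a compact symmetric operator is weakly continuous on bounded families. -/
lemma IsCompactOperator.tendsto_inner_self {ι E : Type*} [NormedAddCommGroup E]
    [InnerProductSpace ℝ E] {F : Ultrafilter ι} {K : E →L[ℝ] E}
    (hcomp : IsCompactOperator K) (hK : ∀ x y : E, ⟪K x, y⟫ = ⟪x, K y⟫)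
    {u : ι → E} {a : E} {R : ℝ} (hR : ∀ i, ‖u i‖ ≤ R)
    (hu : ∀ y : E, Tendsto (fun i => ⟪u i, y⟫) F (𝓝 ⟪a, y⟫)) :
    Tendsto (fun i => ⟪u i, K (u i)⟫) F (𝓝 ⟪a, K a⟫) := by
  obtain ⟨C, hC, hsub⟩ :=
    hcomp.image_closedBall_subset_compact (f := (K : E →ₗ[ℝ] E)) R
  obtain ⟨z, -, hz⟩ := hC.ultrafilter_le_nhds (F.map fun i => K (u i))
    (le_principal_iff.2 (Filter.mem_map.2 (univ_mem' fun i =>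
      hsub ⟨u i, by simpa using hR i, rfl⟩)))
  replace hz : Tendsto (fun i => K (u i)) F (𝓝 z) := hz
  have hza : z = K a := by
    refine ext_inner_right ℝ fun y => tendsto_nhds_unique (hz.inner tendsto_const_nhds) ?_
    simpa only [hK] using hu (K y)
  subst hza
  have hdiff : Tendsto (fun i => ⟪u i, K (u i) - K a⟫) F (𝓝 0) := by
    refine squeeze_zero_norm (a := fun i => R * ‖K (u i) - K a‖) (fun i => ?_) ?_
    · exact (norm_inner_le_norm _ _).trans (by gcongr; exact hR i)
    · simpa using (tendsto_iff_norm_sub_tendsto_zero.1 hz).const_mul R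
  simpa [inner_sub_right] using hdiff.add (hu (K a))

/-- Existence of a global solution of the trust region problem
`min ½⟪x, H x⟫ + ⟪g, x⟫  s.t.  ⟪x, M x⟫ ≤ Δ²`, where `H = P - K` with `P`
self-adjoint positive, `K` self-adjoint compact, and `M` self-adjoint coercive. -/
theorem trust_region_problem_has_solution
    {E : Type*} [NormedAddCommGroup E] [InnerProductSpace ℝ E] [CompleteSpace E]
    (P K : E →L[ℝ] E)
    (hP : ∀ x y : E, ⟪P x, y⟫ = ⟪x, P y⟫)
    (hK : ∀ x y : E, ⟪K x, y⟫ = ⟪x, K y⟫)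
    (hKcompact : IsCompactOperator (⇑K))
    (hPpos : ∀ x : E, 0 ≤ ⟪x, P x⟫)
    (H : E →L[ℝ] E) (hH : H = P - K)
    (M : E →L[ℝ] E)
    (hM : ∀ x y : E, ⟪M x, y⟫ = ⟪x, M y⟫)
    (hcoercive : ∃ c > 0, ∀ x : E, c * ‖x‖ ^ 2 ≤ ⟪x, M x⟫)
    (g : E) (Δ : ℝ) (hΔ : 0 < Δ)
    (q : E → ℝ) (hq : q = fun x => (1 / 2) * ⟪x, H x⟫ + ⟪g, x⟫) :
    ∃ x' : E, ⟪x', M x'⟫ ≤ Δ ^ 2 ∧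
      ∀ x : E, ⟪x, M x⟫ ≤ Δ ^ 2 → q x' ≤ q x := by
  obtain ⟨c, hc, hcM⟩ := hcoercive
  have hMpos (x : E) : 0 ≤ ⟪x, M x⟫ := le_trans (by positivity) (hcM x)
  set S : Set E := {x | ⟪x, M x⟫ ≤ Δ ^ 2} with hS
  have hbound (x : E) (hx : x ∈ S) : ‖x‖ ≤ √(Δ ^ 2 / c) :=
    Real.le_sqrt_of_sq_le ((le_div_iff₀' hc).2 ((hcM x).trans hx))
  set R := √(Δ ^ 2 / c)
  have hbdd : BddBelow (q '' S) := by
    refine ⟨-(1 / 2 * (R * (‖H‖ * R)) + ‖g‖ * R), ?_⟩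
    rintro _ ⟨x, hx, rfl⟩
    have hxR := hbound x hx
    have h₁ : |⟪x, H x⟫| ≤ R * (‖H‖ * R) :=
      (abs_real_inner_le_norm _ _).trans (by gcongr; exact H.le_opNorm_of_le hxR)
    have h₂ : |⟪g, x⟫| ≤ ‖g‖ * R := (abs_real_inner_le_norm _ _).trans (by gcongr)
    simp only [hq]
    linarith [neg_le_of_abs_le h₁, neg_le_of_abs_le h₂]
  have hqx (x : E) : q x = 1 / 2 * (⟪x, P x⟫ - ⟪x, K x⟫) + ⟪x, g⟫ := by
    simp [hq, hH, inner_sub_right, real_inner_comm x g]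
  have hne : (q '' S).Nonempty := ⟨q 0, 0, by simp [hS, sq_nonneg], rfl⟩
  obtain ⟨v, -, hv, hvS⟩ := exists_seq_tendsto_sInf hne hbdd
  choose u huS huv using hvS
  have huR (n : ℕ) : ‖u n‖ ≤ R := hbound _ (huS n)
  let F : Ultrafilter ℕ := hyperfilter ℕ
  obtain ⟨a, ha⟩ := F.exists_tendsto_inner_of_norm_le huR
  refine ⟨a, M.inner_self_le_of_tendsto_inner hM hMpos ha tendsto_const_nhds huS,
    fun x hx => le_trans ?_ (csInf_le hbdd ⟨x, hx, rfl⟩)⟩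
  have hvF : Tendsto v F (𝓝 (sInf (q '' S))) := hv.mono_left Nat.hyperfilter_le_atTop
  have hPa := P.inner_self_le_of_tendsto_inner hP hPpos ha
    (((hvF.sub (ha g)).const_mul 2).add (hKcompact.tendsto_inner_self hK huR ha)) fun n => by
      rw [← huv n, hqx]
      linarith
  rw [hqx]
  linarith
end

section
/- Let E be a real Hilbert space, H and M bounded self-adjoint operators on E, g ∈ E, Δ > 0, and λ ∈ ℝ. Let x⁰, x¹ ∈ E satisfy ⟨x⁰, M x⁰⟩ = Δ² and ⟨x¹, M x¹⟩ = Δ², and suppose (H + λM)x⁰ + g = 0. Then, with d := x¹ − x⁰ and q(x) := ½⟨x, H x⟩ + ⟨g, x⟩, one has q(x¹) − q(x⁰) = ½⟨d, (H + λM)d⟩. -/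
open RealInnerProductSpace

/-- Objective change between two points on the trust region boundary:
if `(H + λM)x⁰ + g = 0` and `x⁰, x¹` both lie on the boundary `‖x‖_M = Δ`,
then `q(x¹) - q(x⁰) = ½⟪d, (H + λM)d⟫` with `d = x¹ - x⁰`. -/
theorem objective_change_on_boundary
    {E : Type*} [NormedAddCommGroup E] [InnerProductSpace ℝ E] [CompleteSpace E]
    (H M : E →L[ℝ] E)
    (hH : ∀ x y : E, ⟪H x, y⟫ = ⟪x, H y⟫)
    (hM : ∀ x y : E, ⟪M x, y⟫ = ⟪x, M y⟫)
    (g : E) (Δ : ℝ) (hΔ : 0 < Δ) (lam : ℝ)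
    (x₀ x₁ : E)
    (hx₀ : ⟪x₀, M x₀⟫ = Δ ^ 2) (hx₁ : ⟪x₁, M x₁⟫ = Δ ^ 2)
    (hstat : H x₀ + lam • M x₀ + g = 0)
    (d : E) (hd : d = x₁ - x₀)
    (q : E → ℝ) (hq : q = fun x => (1 / 2) * ⟪x, H x⟫ + ⟪g, x⟫) :
    q x₁ - q x₀ = (1 / 2) * ⟪d, H d + lam • M d⟫ := by
  subst hd hq
  have hg (x : E) : ⟪x, H x₀⟫ + lam * ⟪x, M x₀⟫ + ⟪g, x⟫ = 0 := by
    have h : ⟪x, H x₀ + lam • M x₀ + g⟫ = 0 := by rw [hstat, inner_zero_right]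
    rwa [inner_add_right, inner_add_right, real_inner_smul_right, real_inner_comm g x] at h
  have hHs : ⟪x₀, H x₁⟫ = ⟪x₁, H x₀⟫ := by rw [← hH, real_inner_comm]
  have hMs : ⟪x₀, M x₁⟫ = ⟪x₁, M x₀⟫ := by rw [← hM, real_inner_comm]
  have h₀ := hg x₀
  have h₁ := hg x₁
  simp only [map_sub, inner_sub_left, inner_sub_right, inner_add_right, real_inner_smul_right,
    hHs, hMs, hx₀, hx₁] at h₀ h₁ ⊢
  linarith
end

section
/- Let E be a real Hilbert space, H a bounded self-adjoint operator on E, M a bounded self-adjoint coercive operator on E, g ∈ E, and Δ > 0. Suppose x* is a global minimizer of q(x) = ½⟨x, H x⟩ + ⟨g, x⟩ over the set { x ∈ E : ⟨x, M x⟩ ≤ Δ² }. Then there exists λ* ≥ 0 such that: (a) (H + λ*M)x* + g = 0; (b) ⟨x*, M x*⟩ ≤ Δ²; (c) λ*(√⟨x*, M x*⟩ − Δ) = 0; (d) ⟨d, (H + λ*M)d⟩ ≥ 0 for all d ∈ E. -/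
open RealInnerProductSpace

open Filter Topology in
theorem eventually_quadratic_neg {a b c : ℝ} (ha : a < 0) :
    ∀ᶠ t in 𝓝[>] (0 : ℝ), a + t * b + t ^ 2 * c < 0 := by
  have hc : ContinuousAt (fun t : ℝ => a + t * b + t ^ 2 * c) 0 := by fun_prop
  exact (hc.eventually_lt_const (by simpa using ha)).filter_mono nhdsWithin_le_nhds

open Filter Topology in
theorem nonneg_of_eventually_quadratic_nonneg {a b c : ℝ}
    (h : ∀ᶠ t in 𝓝[>] (0 : ℝ), 0 ≤ a + t * b + t ^ 2 * c) : 0 ≤ a := by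
  by_contra! ha
  obtain ⟨t, h₁, h₂⟩ := (h.and (eventually_quadratic_neg (b := b) (c := c) ha)).exists
  linarith

/-- Expansion of a symmetric quadratic form along a line. -/
theorem inner_add_smul_map_add_smul {E : Type*} [NormedAddCommGroup E] [InnerProductSpace ℝ E]
    {A : E →L[ℝ] E} (hA : ∀ x y : E, ⟪A x, y⟫ = ⟪x, A y⟫) (x d : E) (t : ℝ) :
    ⟪x + t • d, A (x + t • d)⟫ = ⟪x, A x⟫ + 2 * t * ⟪A x, d⟫ + t ^ 2 * ⟪d, A d⟫ := by
  simp only [map_add, map_smul, inner_add_left, inner_add_right, real_inner_smul_left,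
    real_inner_smul_right]
  rw [← hA x d, real_inner_comm (A x) d]
  ring

/-- Necessary optimality conditions for the trust region problem:
a global minimizer `x*` of `q(x) = ½⟪x, H x⟫ + ⟪g, x⟫` over `{x : ⟪x, M x⟫ ≤ Δ²}`
admits a multiplier `λ* ≥ 0` with stationarity, feasibility, complementarity,
and positive semidefiniteness of `H + λ*M`. -/
theorem trust_region_necessary_optimality
    {E : Type*} [NormedAddCommGroup E] [InnerProductSpace ℝ E] [CompleteSpace E]
    (H M : E →L[ℝ] E)
    (hH : ∀ x y : E, ⟪H x, y⟫ = ⟪x, H y⟫)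
    (hM : ∀ x y : E, ⟪M x, y⟫ = ⟪x, M y⟫)
    (hcoercive : ∃ c > 0, ∀ x : E, c * ‖x‖ ^ 2 ≤ ⟪x, M x⟫)
    (g : E) (Δ : ℝ) (hΔ : 0 < Δ)
    (q : E → ℝ) (hq : q = fun x => (1 / 2) * ⟪x, H x⟫ + ⟪g, x⟫)
    (xs : E)
    (hfeas : ⟪xs, M xs⟫ ≤ Δ ^ 2)
    (hmin : ∀ x : E, ⟪x, M x⟫ ≤ Δ ^ 2 → q xs ≤ q x) :
    ∃ lam : ℝ, 0 ≤ lam ∧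
      H xs + lam • M xs + g = 0 ∧
      ⟪xs, M xs⟫ ≤ Δ ^ 2 ∧
      lam * (Real.sqrt ⟪xs, M xs⟫ - Δ) = 0 ∧
      ∀ d : E, 0 ≤ ⟪d, H d + lam • M d⟫ := by
  subst hq
  obtain ⟨c, hc, hcM⟩ := hcoercive
  have key : ∀ (d : E) (t : ℝ), ⟪xs, M xs⟫ + 2 * t * ⟪M xs, d⟫ + t ^ 2 * ⟪d, M d⟫ ≤ Δ ^ 2 →
      0 ≤ t * ⟪H xs + g, d⟫ + t ^ 2 * (⟪d, H d⟫ / 2) := by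
    intro d t ht
    have h := hmin (xs + t • d) (by rwa [inner_add_smul_map_add_smul hM])
    simp only [inner_add_smul_map_add_smul hH, inner_add_right, real_inner_smul_right] at h
    rw [inner_add_left]
    linarith
  rcases hfeas.lt_or_eq with hlt | heq
  · have hev : ∀ d : E, ∀ᶠ t in nhdsWithin (0 : ℝ) (Set.Ioi 0),
        0 ≤ ⟪H xs + g, d⟫ + t * (⟪d, H d⟫ / 2) := by
      intro d
      filter_upwards [eventually_quadratic_neg (a := ⟪xs, M xs⟫ - Δ ^ 2) (b := 2 * ⟪M xs, d⟫)
        (c := ⟪d, M d⟫) (by linarith), self_mem_nhdsWithin] with t ht ht0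
      refine nonneg_of_mul_nonneg_right ?_ (Set.mem_Ioi.mp ht0)
      linarith [key d t (by linarith)]
    have hnonneg : ∀ d : E, 0 ≤ ⟪H xs + g, d⟫ := fun d =>
      nonneg_of_eventually_quadratic_nonneg (b := ⟪d, H d⟫ / 2) (c := 0)
        (by simpa using hev d)
    have hzero : H xs + g = 0 := by
      have h := hnonneg (-(H xs + g))
      rw [inner_neg_right] at h
      exact real_inner_self_nonpos.mp (by linarith)
    refine ⟨0, le_rfl, by simpa using hzero, hfeas, zero_mul _, fun d => ?_⟩
    obtain ⟨t, ht, ht0⟩ := ((hev d).and self_mem_nhdsWithin).exists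
    rw [hzero, inner_zero_left, zero_add] at ht
    have := nonneg_of_mul_nonneg_right ht (Set.mem_Ioi.mp ht0)
    rw [zero_smul, add_zero]
    linarith
  · have hΔ2 : 0 < Δ ^ 2 := by positivity
    have hxw : ⟪M xs, xs⟫ = Δ ^ 2 := by rw [hM, heq]
    have hstrict : ∀ d : E, ⟪M xs, d⟫ < 0 → 0 ≤ ⟪H xs + g, d⟫ := by
      intro d hd
      refine nonneg_of_eventually_quadratic_nonneg (b := ⟪d, H d⟫ / 2) (c := 0) ?_
      filter_upwards [eventually_quadratic_neg (a := 2 * ⟪M xs, d⟫) (b := ⟪d, M d⟫) (c := 0)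
        (by linarith), self_mem_nhdsWithin] with t ht ht0
      have ht0 : 0 < t := ht0
      refine nonneg_of_mul_nonneg_right ?_ ht0
      linarith [key d t (by nlinarith)]
    have hweak : ∀ d : E, ⟪M xs, d⟫ = 0 → 0 ≤ ⟪H xs + g, d⟫ := by
      intro d hd
      refine nonneg_of_eventually_quadratic_nonneg (b := -⟪H xs + g, xs⟫) (c := 0) ?_
      filter_upwards [self_mem_nhdsWithin] with t ht0
      have ht0 : 0 < t := ht0
      have h := hstrict (d - t • xs) (by
        rw [inner_sub_right, real_inner_smul_right, hd, hxw]
        linarith [mul_pos ht0 hΔ2])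
      rw [inner_sub_right, real_inner_smul_right] at h
      linarith
    have hperp : ∀ d : E, ⟪M xs, d⟫ = 0 → ⟪H xs + g, d⟫ = 0 := by
      intro d hd
      have h := hweak (-d) (by rw [inner_neg_right, hd, neg_zero])
      rw [inner_neg_right] at h
      linarith [hweak d hd]
    obtain ⟨lam, hlam⟩ : ∃ lam : ℝ, lam * Δ ^ 2 = -⟪H xs + g, xs⟫ :=
      ⟨-⟪H xs + g, xs⟫ / Δ ^ 2, div_mul_cancel₀ _ hΔ2.ne'⟩
    have hstat : ∀ d : E, ⟪H xs + g, d⟫ + lam * ⟪M xs, d⟫ = 0 := by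
      intro d
      have h := hperp (d - (⟪M xs, d⟫ / Δ ^ 2) • xs) (by
        rw [inner_sub_right, real_inner_smul_right, hxw, div_mul_cancel₀ _ hΔ2.ne', sub_self])
      rw [inner_sub_right, real_inner_smul_right, ← neg_eq_iff_eq_neg.mpr hlam] at h
      have h' : ⟪M xs, d⟫ / Δ ^ 2 * -(lam * Δ ^ 2) = -(lam * ⟪M xs, d⟫) := by
        field_simp
      linarith
    have hcurv : ∀ d : E, ⟪M xs, d⟫ ≠ 0 → 0 ≤ ⟪d, H d⟫ + lam * ⟪d, M d⟫ := by
      intro d hd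
      have hd0 : d ≠ 0 := by rintro rfl; simp at hd
      have hdM : 0 < ⟪d, M d⟫ := lt_of_lt_of_le (by positivity) (hcM d)
      obtain ⟨t, ht⟩ : ∃ t : ℝ, t * ⟪d, M d⟫ = -2 * ⟪M xs, d⟫ :=
        ⟨-2 * ⟪M xs, d⟫ / ⟪d, M d⟫, div_mul_cancel₀ _ hdM.ne'⟩
      have ht0 : t ≠ 0 := by
        rintro rfl
        exact hd (by linarith)
      have h := key d t (by rw [heq]; linear_combination t * ht)
      refine nonneg_of_mul_nonneg_right (a := t ^ 2 / 2) ?_ (by positivity)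
      linear_combination h + t * hstat d - lam * t / 2 * ht
    refine ⟨lam, ?_, ?_, hfeas, ?_, fun d => ?_⟩
    · have h := hstrict (-xs) (by rw [inner_neg_right, hxw]; linarith)
      rw [inner_neg_right, ← hlam] at h
      exact nonneg_of_mul_nonneg_left h hΔ2
    · refine ext_inner_right ℝ fun d => ?_
      have h := hstat d
      rw [inner_add_left] at h
      rw [inner_add_left, inner_add_left, real_inner_smul_left, inner_zero_left]
      linarith
    · rw [heq, Real.sqrt_sq hΔ.le, sub_self, mul_zero]
    · rw [inner_add_right, real_inner_smul_right]
      by_cases hd : ⟪M xs, d⟫ = 0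
      · refine nonneg_of_eventually_quadratic_nonneg (b := 2 * ⟪H d, xs⟫ + lam * (2 * ⟪M d, xs⟫))
          (c := ⟪xs, H xs⟫ + lam * ⟪xs, M xs⟫) ?_
        filter_upwards [self_mem_nhdsWithin] with t ht0
        have ht0 : 0 < t := ht0
        have h := hcurv (d + t • xs) (by
          rw [inner_add_right, real_inner_smul_right, hd, hxw, zero_add]
          positivity)
        rw [inner_add_smul_map_add_smul hH, inner_add_smul_map_add_smul hM] at h
        linarith
      · exact hcurv d hd
end

section
/- Let E be a real Hilbert space, H a bounded self-adjoint operator on E, M a bounded self-adjoint coercive operator on E, g ∈ E, and Δ > 0. Suppose x* ∈ E and λ* ≥ 0 satisfy: (a) (H + λ*M)x* + g = 0; (b) ⟨x*, M x*⟩ ≤ Δ²; (c) λ*(√⟨x*, M x*⟩ − Δ) = 0; and additionally ⟨d, (H + λ*M)d⟩ > 0 for every d ∈ E with d ≠ 0. Then x* is the unique global minimizer of q(x) = ½⟨x, H x⟩ + ⟨g, x⟩ over { x ∈ E : ⟨x, M x⟩ ≤ Δ² }: q(x*) < q(x) for every feasible x ≠ x*. -/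
open RealInnerProductSpace

/-- Sufficient optimality condition for the trust region problem: if `(x*, λ*)`
satisfies the KKT conditions and `H + λ*M` is positive definite, then `x*` is
the unique global minimizer over the trust region. -/
theorem trust_region_sufficient_optimality
    {E : Type*} [NormedAddCommGroup E] [InnerProductSpace ℝ E] [CompleteSpace E]
    (H M : E →L[ℝ] E)
    (hH : ∀ x y : E, ⟪H x, y⟫ = ⟪x, H y⟫)
    (hM : ∀ x y : E, ⟪M x, y⟫ = ⟪x, M y⟫)
    (hcoercive : ∃ c > 0, ∀ x : E, c * ‖x‖ ^ 2 ≤ ⟪x, M x⟫)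
    (g : E) (Δ : ℝ) (hΔ : 0 < Δ)
    (q : E → ℝ) (hq : q = fun x => (1 / 2) * ⟪x, H x⟫ + ⟪g, x⟫)
    (xs : E) (lam : ℝ) (hlam : 0 ≤ lam)
    (hstat : H xs + lam • M xs + g = 0)
    (hfeas : ⟪xs, M xs⟫ ≤ Δ ^ 2)
    (hcomp : lam * (Real.sqrt ⟪xs, M xs⟫ - Δ) = 0)
    (hpd : ∀ d : E, d ≠ 0 → 0 < ⟪d, H d + lam • M d⟫) :
    ∀ x : E, ⟪x, M x⟫ ≤ Δ ^ 2 → x ≠ xs → q xs < q x := by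
  intro x hx hne
  obtain ⟨c, hc, hcM⟩ := hcoercive
  have hxs : 0 ≤ ⟪xs, M xs⟫ := le_trans (by positivity) (hcM xs)
  have hact : lam * ⟪xs, M xs⟫ = lam * Δ ^ 2 := by
    rcases mul_eq_zero.mp hcomp with h | h
    · simp [h]
    · rw [← Real.sq_sqrt hxs, sub_eq_zero.mp h]
  have hgap : 0 ≤ lam * (Δ ^ 2 - ⟪x, M x⟫) := mul_nonneg hlam (sub_nonneg.mpr hx)
  have hpos := hpd (x - xs) (sub_ne_zero.mpr hne)
  have hstat_x : ⟪x, H xs + lam • M xs + g⟫ = 0 := by rw [hstat, inner_zero_right]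
  have hstat_xs : ⟪xs, H xs + lam • M xs + g⟫ = 0 := by rw [hstat, inner_zero_right]
  have hHsymm : ⟪xs, H x⟫ = ⟪x, H xs⟫ := by rw [← hH, real_inner_comm]
  have hMsymm : ⟪xs, M x⟫ = ⟪x, M xs⟫ := by rw [← hM, real_inner_comm]
  simp only [map_sub, inner_add_right, inner_sub_left, inner_sub_right,
    real_inner_smul_right, hHsymm, hMsymm] at hpos hstat_x hstat_xs
  simp only [hq, real_inner_comm _ g]
  linarith
end

section
/- Let E be a real Hilbert space, H a bounded self-adjoint operator on E, M a bounded self-adjoint coercive operator on E, g ∈ E, Δ > 0, and let X ⊆ E be a closed linear subspace. Suppose xᵢ is a global minimizer of q(x) = ½⟨x, H x⟩ + ⟨g, x⟩ over { x ∈ X : ⟨x, M x⟩ ≤ Δ² }. Then there exists λᵢ ≥ 0 such that: (a) ⟨(H + λᵢM)xᵢ + g, y⟩ = 0 for all y ∈ X; (b) ⟨xᵢ, M xᵢ⟩ ≤ Δ²; (c) λᵢ(√⟨xᵢ, M xᵢ⟩ − Δ) = 0; (d) ⟨d, (H + λᵢM)d⟩ ≥ 0 for all d ∈ X. -/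
open RealInnerProductSpace

/-- A continuous real function that is nonnegative on `(0, δ)` is nonnegative at `0`. -/
theorem nonneg_at_zero_of_nonneg_on_Ioo {f : ℝ → ℝ} (hf : Continuous f) {δ : ℝ} (hδ : 0 < δ)
    (h : ∀ t, 0 < t → t < δ → 0 ≤ f t) : 0 ≤ f 0 := by
  refine ge_of_tendsto (hf.continuousAt.continuousWithinAt (s := Set.Ioi 0)) ?_
  filter_upwards [Ioo_mem_nhdsGT hδ] with t ht using h t ht.1 ht.2

/-- If `φ 0 < 0`, or `φ 0 = 0` with negative slope, a real quadratic `φ` is nonpositive on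
some interval `(0, δ)`. -/
theorem exists_quadratic_nonpos_on_Ioo {a b c : ℝ} (h : a < 0 ∨ a ≤ 0 ∧ b < 0) :
    ∃ δ > 0, ∀ t, 0 < t → t < δ → a + t * b + t ^ 2 * c ≤ 0 := by
  rcases h with h | ⟨ha, hb⟩
  · have hev : ∀ᶠ t in nhdsWithin (0 : ℝ) (Set.Ioi 0), a + t * b + t ^ 2 * c < 0 := by
      have hc : Continuous fun t : ℝ => a + t * b + t ^ 2 * c := by fun_prop
      exact hc.continuousWithinAt.eventually_lt_const (by simpa using h)
    obtain ⟨δ, hδ, hs⟩ := (mem_nhdsGT_iff_exists_Ioo_subset).1 hev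
    exact ⟨δ, hδ, fun t h0 h1 => le_of_lt (hs ⟨h0, h1⟩)⟩
  · have hev : ∀ᶠ t in nhdsWithin (0 : ℝ) (Set.Ioi 0), b + t * c < 0 := by
      have hc : Continuous fun t : ℝ => b + t * c := by fun_prop
      exact hc.continuousWithinAt.eventually_lt_const (by simpa using hb)
    obtain ⟨δ, hδ, hs⟩ := (mem_nhdsGT_iff_exists_Ioo_subset).1 hev
    refine ⟨δ, hδ, fun t h0 h1 => ?_⟩
    have hneg : b + t * c < 0 := hs ⟨h0, h1⟩
    nlinarith [mul_neg_of_pos_of_neg h0 hneg]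

/-- Necessary optimality conditions for the truncated trust region problem on a
closed subspace `X`: a global minimizer over `{x ∈ X : ⟪x, M x⟫ ≤ Δ²}` admits a
multiplier `λᵢ ≥ 0` with stationarity orthogonal to `X`, feasibility,
complementarity, and positive semidefiniteness of `H + λᵢM` on `X`. -/
theorem truncated_trust_region_necessary_optimality
    {E : Type*} [NormedAddCommGroup E] [InnerProductSpace ℝ E] [CompleteSpace E]
    (H M : E →L[ℝ] E)
    (hH : ∀ x y : E, ⟪H x, y⟫ = ⟪x, H y⟫)
    (hM : ∀ x y : E, ⟪M x, y⟫ = ⟪x, M y⟫)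
    (hcoercive : ∃ c > 0, ∀ x : E, c * ‖x‖ ^ 2 ≤ ⟪x, M x⟫)
    (g : E) (Δ : ℝ) (hΔ : 0 < Δ)
    (q : E → ℝ) (hq : q = fun x => (1 / 2) * ⟪x, H x⟫ + ⟪g, x⟫)
    (X : Submodule ℝ E) (hX : IsClosed (X : Set E))
    (xi : E) (hxi : xi ∈ X)
    (hfeas : ⟪xi, M xi⟫ ≤ Δ ^ 2)
    (hmin : ∀ x ∈ X, ⟪x, M x⟫ ≤ Δ ^ 2 → q xi ≤ q x) :
    ∃ lam : ℝ, 0 ≤ lam ∧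
      (∀ y ∈ X, ⟪H xi + lam • M xi + g, y⟫ = 0) ∧
      ⟪xi, M xi⟫ ≤ Δ ^ 2 ∧
      lam * (Real.sqrt ⟪xi, M xi⟫ - Δ) = 0 ∧
      ∀ d ∈ X, 0 ≤ ⟪d, H d + lam • M d⟫ := by
  have hq_line : ∀ (d : E) (t : ℝ),
      q (xi + t • d) = q xi + t * ⟪H xi + g, d⟫ + t ^ 2 / 2 * ⟪d, H d⟫ := by
    intro d t
    simp only [hq, map_add, map_smul, inner_add_left, inner_add_right, real_inner_smul_left,
      real_inner_smul_right]
    rw [hH xi d, real_inner_comm (H xi) d, hH xi d]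
    ring
  have hM_line : ∀ (d : E) (t : ℝ), ⟪xi + t • d, M (xi + t • d)⟫
      = ⟪xi, M xi⟫ + t * (2 * ⟪M xi, d⟫) + t ^ 2 * ⟪d, M d⟫ := by
    intro d t
    simp only [map_add, map_smul, inner_add_left, inner_add_right, real_inner_smul_left,
      real_inner_smul_right]
    rw [real_inner_comm (M xi) d, hM xi d]
    ring
  have hmin_line : ∀ d ∈ X, ∀ t : ℝ,
      (⟪xi, M xi⟫ - Δ ^ 2) + t * (2 * ⟪M xi, d⟫) + t ^ 2 * ⟪d, M d⟫ ≤ 0 →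
      0 ≤ t * ⟪H xi + g, d⟫ + t ^ 2 / 2 * ⟪d, H d⟫ := by
    intro d hd t ht
    have hle := hmin _ (X.add_mem hxi (X.smul_mem t hd)) (by rw [hM_line]; linarith)
    rw [hq_line] at hle
    linarith
  have hdescent : ∀ d ∈ X, (⟪xi, M xi⟫ - Δ ^ 2 < 0 ∨
      ⟪xi, M xi⟫ - Δ ^ 2 ≤ 0 ∧ 2 * ⟪M xi, d⟫ < 0) →
      ∃ δ > 0, ∀ t, 0 < t → t < δ → 0 ≤ ⟪H xi + g, d⟫ + t / 2 * ⟪d, H d⟫ := by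
    intro d hd h
    obtain ⟨δ, hδ, hs⟩ := exists_quadratic_nonpos_on_Ioo (c := ⟪d, M d⟫) h
    refine ⟨δ, hδ, fun t h0 h1 => ?_⟩
    refine nonneg_of_mul_nonneg_right ?_ h0
    linarith [hmin_line d hd t (hs t h0 h1)]
  have hfirst : ∀ d ∈ X, (⟪xi, M xi⟫ - Δ ^ 2 < 0 ∨
      ⟪xi, M xi⟫ - Δ ^ 2 ≤ 0 ∧ 2 * ⟪M xi, d⟫ < 0) → 0 ≤ ⟪H xi + g, d⟫ := by
    intro d hd h
    obtain ⟨δ, hδ, hs⟩ := hdescent d hd h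
    simpa using nonneg_at_zero_of_nonneg_on_Ioo
      (f := fun t => ⟪H xi + g, d⟫ + t / 2 * ⟪d, H d⟫) (by fun_prop) hδ hs
  rcases hfeas.lt_or_eq with hlt | heq
  · have hstat : ∀ d ∈ X, ⟪H xi + g, d⟫ = 0 := by
      intro d hd
      have hpos := hfirst d hd (.inl (by linarith))
      have hneg := hfirst (-d) (X.neg_mem hd) (.inl (by linarith))
      rw [inner_neg_right] at hneg
      linarith
    refine ⟨0, le_rfl, by simpa using hstat, hfeas, by simp, fun d hd => ?_⟩
    obtain ⟨δ, hδ, hs⟩ := hdescent d hd (.inl (by linarith))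
    have h := hs (δ / 2) (by linarith) (by linarith)
    rw [hstat d hd, zero_add] at h
    simpa using nonneg_of_mul_nonneg_right h (by positivity)
  · have hΔ2 : 0 < Δ ^ 2 := by positivity
    have hMx : ⟪M xi, xi⟫ = Δ ^ 2 := by rw [real_inner_comm, heq]
    set lam : ℝ := -⟪H xi + g, xi⟫ / Δ ^ 2
    have hlam_mul : lam * Δ ^ 2 = -⟪H xi + g, xi⟫ := div_mul_cancel₀ _ hΔ2.ne'
    have htangent : ∀ d ∈ X, ⟪M xi, d⟫ = 0 → 0 ≤ ⟪H xi + g, d⟫ := by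
      intro d hd hMd
      have h := nonneg_at_zero_of_nonneg_on_Ioo
        (f := fun t => ⟪H xi + g, d⟫ - t * ⟪H xi + g, xi⟫) (by fun_prop) one_pos ?_
      · simpa using h
      · intro t ht _
        have h := hfirst (d - t • xi) (X.sub_mem hd (X.smul_mem t hxi)) (.inr ⟨by linarith, by
          rw [inner_sub_right, real_inner_smul_right, hMd, hMx]
          nlinarith [mul_pos ht hΔ2]⟩)
        rwa [inner_sub_right, real_inner_smul_right] at h
    have hstat : ∀ d ∈ X, ⟪H xi + g, d⟫ = -(lam * ⟪M xi, d⟫) := by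
      intro d hd
      set s : ℝ := ⟪M xi, d⟫ / Δ ^ 2
      have hs_mul : s * Δ ^ 2 = ⟪M xi, d⟫ := div_mul_cancel₀ _ hΔ2.ne'
      have hmem : d - s • xi ∈ X := X.sub_mem hd (X.smul_mem s hxi)
      have hMd : ⟪M xi, d - s • xi⟫ = 0 := by
        rw [inner_sub_right, real_inner_smul_right, hMx, hs_mul, sub_self]
      have hpos := htangent _ hmem hMd
      have hneg := htangent _ (X.neg_mem hmem) (by rw [inner_neg_right, hMd, neg_zero])
      rw [inner_neg_right] at hneg
      rw [inner_sub_right, real_inner_smul_right] at hpos hneg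
      have hzero : ⟪H xi + g, d⟫ = s * ⟪H xi + g, xi⟫ := by linarith
      rw [hzero, ← hs_mul]
      linear_combination s * hlam_mul
    -- Reflecting `xi` along `d` in the `M`-inner product stays on the sphere.
    have hcurv : ∀ d ∈ X, ⟪M xi, d⟫ ≠ 0 → 0 ≤ ⟪d, H d⟫ + lam * ⟪d, M d⟫ := by
      intro d hd hne
      obtain ⟨c, hc, hcM⟩ := hcoercive
      have hd0 : d ≠ 0 := by rintro rfl; simp at hne
      have hMd : 0 < ⟪d, M d⟫ :=
        lt_of_lt_of_le (mul_pos hc (pow_pos (norm_pos_iff.2 hd0) 2)) (hcM d)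
      set t : ℝ := -2 * ⟪M xi, d⟫ / ⟪d, M d⟫
      have ht_mul : t * ⟪d, M d⟫ = -2 * ⟪M xi, d⟫ := div_mul_cancel₀ _ hMd.ne'
      have ht0 : t ≠ 0 := div_ne_zero (mul_ne_zero (by norm_num) hne) hMd.ne'
      have h := hmin_line d hd t (le_of_eq (by linear_combination heq + t * ht_mul))
      rw [hstat d hd] at h
      refine nonneg_of_mul_nonneg_right (a := t ^ 2 / 2) ?_ (by positivity)
      linear_combination h - lam * t / 2 * ht_mul
    refine ⟨lam, ?_, fun y hy => ?_, hfeas, ?_, fun d hd => ?_⟩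
    · have h := hfirst (-xi) (X.neg_mem hxi) (.inr ⟨by linarith, by
        rw [inner_neg_right, hMx]; linarith⟩)
      rw [inner_neg_right] at h
      exact div_nonneg h hΔ2.le
    · have h := hstat y hy
      rw [inner_add_left] at h
      rw [inner_add_left, inner_add_left, real_inner_smul_left]
      linarith
    · rw [heq, Real.sqrt_sq hΔ.le, sub_self, mul_zero]
    · rw [inner_add_right, real_inner_smul_right]
      by_cases hne : ⟪M xi, d⟫ = 0
      · have h := nonneg_at_zero_of_nonneg_on_Ioo
          (f := fun t => ⟪d + t • xi, H (d + t • xi)⟫ + lam * ⟪d + t • xi, M (d + t • xi)⟫)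
          (by fun_prop) one_pos fun t ht _ =>
            hcurv _ (X.add_mem hd (X.smul_mem t hxi)) (by
              rw [inner_add_right, real_inner_smul_right, hne, hMx, zero_add]
              positivity)
        simpa using h
      · exact hcurv d hd hne
end

section
/- Let T be a real symmetric (n+1)×(n+1) tridiagonal matrix (entries indexed 0,…,n; T(j,k) = 0 for |j−k| > 1) whose subdiagonal entries T(j+1, j) are all strictly positive. Then there exists λ̂ > 0 such that for every λ ≥ λ̂ the matrix T + λI is invertible, and the function λ ↦ |⟨e_n, (T + λI)⁻¹ e₀⟩| (the absolute value of the last component of (T + λI)⁻¹e₀) is antitone on [λ̂, ∞): for λ̂ ≤ μ ≤ λ one has |⟨e_n, (T + λI)⁻¹ e₀⟩| ≤ |⟨e_n, (T + μI)⁻¹ e₀⟩|. -/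
open Matrix

/-- A real polynomial with positive leading coefficient is eventually positive. -/
theorem Polynomial.eventually_eval_pos_of_leadingCoeff_pos {p : Polynomial ℝ}
    (hp : 0 < p.leadingCoeff) : ∀ᶠ x in Filter.atTop, 0 < p.eval x := by
  by_cases hdeg : 0 < p.degree
  · exact (p.tendsto_atTop_of_leadingCoeff_nonneg hdeg hp.le).eventually_gt_atTop 0
  · have hC := Polynomial.eq_C_of_degree_le_zero (not_lt.mp hdeg)
    rw [hC, Polynomial.leadingCoeff_C] at hp
    rw [hC]
    exact .of_forall fun x => by rwa [Polynomial.eval_C]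

/-- A nonconstant monic real polynomial is positive and monotone on some `[a, ∞)`. -/
theorem Polynomial.Monic.exists_pos_and_monotoneOn_Ici {p : Polynomial ℝ}
    (hp : p.Monic) (hdeg : 0 < p.natDegree) :
    ∃ a : ℝ, 0 < a ∧ (∀ x, a ≤ x → 0 < p.eval x) ∧
      MonotoneOn (fun x => p.eval x) (Set.Ici a) := by
  have hp' : 0 < p.derivative.leadingCoeff := by
    rw [Polynomial.leadingCoeff_derivative, hp.leadingCoeff]
    simpa using hdeg
  obtain ⟨a, ha⟩ := Filter.eventually_atTop.mp
    ((Polynomial.eventually_eval_pos_of_leadingCoeff_pos (hp.leadingCoeff.symm ▸ one_pos)).and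
      ((Polynomial.eventually_eval_pos_of_leadingCoeff_pos hp').and
        (Filter.eventually_gt_atTop 0)))
  refine ⟨a, (ha a le_rfl).2.2, fun x hx => (ha x hx).1, ?_⟩
  refine monotoneOn_of_deriv_nonneg (convex_Ici a) p.continuous.continuousOn
    p.differentiable.differentiableOn fun x hx => ?_
  rw [interior_Ici] at hx
  rw [Polynomial.deriv]
  exact (ha x (le_of_lt hx)).2.1.le

/-- For a matrix `A` that vanishes below the subdiagonal, the lower left entry of the adjugate is,
up to sign, the product of the subdiagonal entries. -/
theorem Matrix.adjugate_last_zero_of_hessenberg {R : Type*} [CommRing R] {n : ℕ}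
    (A : Matrix (Fin (n + 1)) (Fin (n + 1)) R)
    (hA : ∀ j k : Fin (n + 1), (k : ℕ) + 1 < (j : ℕ) → A j k = 0) :
    A.adjugate (Fin.last n) 0 = (-1) ^ n * ∏ j : Fin n, A j.succ j.castSucc := by
  rw [Matrix.adjugate_fin_succ_eq_det_submatrix, Matrix.det_of_isUpperTriangular]
  · simp
  · intro i j hij
    have hij' : (j : ℕ) < i := hij
    exact hA _ _ (by simpa using hij')

/-- For a symmetric tridiagonal matrix `T` with strictly positive subdiagonal,
there is `λ̂ > 0` such that `T + λI` is invertible for `λ ≥ λ̂` and the last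
component of `(T + λI)⁻¹e₀` is, in absolute value, antitone in `λ` on `[λ̂, ∞)`. -/
theorem gltr_residual_antitone_in_radius
    {n : ℕ}
    (T : Matrix (Fin (n + 1)) (Fin (n + 1)) ℝ)
    (hsymm : T.IsSymm)
    (htridiag : ∀ j k : Fin (n + 1), (j : ℕ) + 1 < (k : ℕ) ∨ (k : ℕ) + 1 < (j : ℕ) → T j k = 0)
    (hsub : ∀ j : Fin n, 0 < T j.succ j.castSucc)
    (e₀ : Fin (n + 1) → ℝ) (he₀ : e₀ = fun i => if i = 0 then 1 else 0) :
    ∃ lamhat : ℝ, 0 < lamhat ∧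
      (∀ lam : ℝ, lamhat ≤ lam → IsUnit (T + lam • (1 : Matrix (Fin (n + 1)) (Fin (n + 1)) ℝ))) ∧
      (∀ μ lam : ℝ, lamhat ≤ μ → μ ≤ lam →
        |((T + lam • 1)⁻¹ *ᵥ e₀) (Fin.last n)| ≤ |((T + μ • 1)⁻¹ *ᵥ e₀) (Fin.last n)|) := by
  obtain ⟨a, ha, hpos, hmono⟩ := (Matrix.charpoly_monic (-T)).exists_pos_and_monotoneOn_Ici
    (by simp [Matrix.charpoly_natDegree_eq_dim])
  have hdet (x : ℝ) : (T + x • (1 : Matrix (Fin (n + 1)) (Fin (n + 1)) ℝ)).det =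
      (-T).charpoly.eval x := by
    rw [Matrix.eval_charpoly, sub_neg_eq_add, add_comm T, Matrix.smul_one_eq_diagonal]
    rfl
  have hentry (x : ℝ) : ((T + x • 1)⁻¹ *ᵥ e₀) (Fin.last n) =
      ((-T).charpoly.eval x)⁻¹ * ((-1) ^ n * ∏ j : Fin n, T j.succ j.castSucc) := by
    have he : e₀ = Pi.single 0 1 := by
      ext i
      simp [he₀, Pi.single_apply]
    rw [he, Matrix.mulVec_single_one, Matrix.col_apply, Matrix.inv_def, Matrix.smul_apply,
      Matrix.adjugate_last_zero_of_hessenberg, hdet, Ring.inverse_eq_inv', smul_eq_mul]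
    · simp [(Fin.castSucc_lt_succ).ne']
    · intro j k hjk
      have hne : j ≠ k := by
        rintro rfl
        omega
      simp [htridiag j k (Or.inr hjk), hne]
  refine ⟨a, ha, fun x hx => ?_, fun y x hy hyx => ?_⟩
  · rw [Matrix.isUnit_iff_isUnit_det, hdet]
    exact (hpos x hx).ne'.isUnit
  · have hx := hy.trans hyx
    rw [hentry, hentry, abs_mul _⁻¹, abs_mul ((-T).charpoly.eval y)⁻¹, abs_of_pos (inv_pos.mpr (hpos x hx)),
      abs_of_pos (inv_pos.mpr (hpos y hy))]
    exact mul_le_mul_of_nonneg_right (inv_anti₀ (hpos y hy) (hmono hy hx hyx)) (abs_nonneg _)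
end

section
/- Let E be a real Hilbert space, A and M bounded self-adjoint operators on E, and let p₀,…,p_n ∈ E be M-orthonormal: ⟨p_j, M p_k⟩ = 1 if j = k and = 0 otherwise. Let T be a real symmetric (n+1)×(n+1) matrix, g' ∈ E with ⟨p_j, g'⟩ = 0 for all 0 ≤ j ≤ n, and suppose the Lanczos compact-form relations hold: A p_j = Σ_{k=0}^{n} T(k,j) · M p_k for j < n, and A p_n = Σ_{k=0}^{n} T(k,n) · M p_k + g'. Let γ₀ ∈ ℝ and g := γ₀ · M p₀. Then for every coefficient vector h ∈ ℝ^{n+1}, the point x := Σ_{j=0}^{n} h_j p_j satisfies ½⟨x, A x⟩ + ⟨g, x⟩ = ½ hᵀ T h + γ₀ h₀ and ⟨x, M x⟩ = Σ_{j=0}^{n} h_j². -/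
open Matrix RealInnerProductSpace

/-- The quadratic form of an operator on the span of a finite family, in coordinates. -/
theorem inner_sum_smul_apply_sum_smul {E ι : Type*} [NormedAddCommGroup E]
    [InnerProductSpace ℝ E] [Fintype ι] (B : E →L[ℝ] E) (p : ι → E) (S : Matrix ι ι ℝ)
    (hS : ∀ i j, ⟪p i, B (p j)⟫ = S i j) (h : ι → ℝ) :
    ⟪∑ j, h j • p j, B (∑ j, h j • p j)⟫ = h ⬝ᵥ (S *ᵥ h) := by
  simp only [map_sum, map_smul, sum_inner, inner_sum, real_inner_smul_left,
    real_inner_smul_right, hS, dotProduct, mulVec, Finset.mul_sum]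
  rw [Finset.sum_comm]
  exact Finset.sum_congr rfl fun i _ => Finset.sum_congr rfl fun j _ => by ring

/-- Coordinate representation of the trust region objective and constraint in
an `M`-orthonormal Lanczos basis: if the compact-form Lanczos relations hold,
then for `x = Σ hⱼ pⱼ` one has `½⟪x, A x⟫ + ⟪g, x⟫ = ½hᵀTh + γ₀h₀` and
`⟪x, M x⟫ = Σ hⱼ²`. -/
theorem lanczos_coordinate_representation
    {E : Type*} [NormedAddCommGroup E] [InnerProductSpace ℝ E] [CompleteSpace E]
    (A M : E →L[ℝ] E)
    (hA : ∀ x y : E, ⟪A x, y⟫ = ⟪x, A y⟫)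
    (hM : ∀ x y : E, ⟪M x, y⟫ = ⟪x, M y⟫)
    {n : ℕ} (p : Fin (n + 1) → E)
    (horth : ∀ j k : Fin (n + 1), ⟪p j, M (p k)⟫ = if j = k then 1 else 0)
    (T : Matrix (Fin (n + 1)) (Fin (n + 1)) ℝ) (hT : T.IsSymm)
    (g' : E) (hg' : ∀ j : Fin (n + 1), ⟪p j, g'⟫ = 0)
    (hlan : ∀ j : Fin (n + 1), j ≠ Fin.last n → A (p j) = ∑ k, T k j • M (p k))
    (hlanlast : A (p (Fin.last n)) = (∑ k, T k (Fin.last n) • M (p k)) + g')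
    (γ₀ : ℝ) (g : E) (hg : g = γ₀ • M (p 0)) :
    ∀ h : Fin (n + 1) → ℝ,
      ((1 : ℝ) / 2) * ⟪∑ j, h j • p j, A (∑ j, h j • p j)⟫ + ⟪g, ∑ j, h j • p j⟫
          = (1 / 2) * (h ⬝ᵥ (T *ᵥ h)) + γ₀ * h 0 ∧
      ⟪∑ j, h j • p j, M (∑ j, h j • p j)⟫ = ∑ j, h j ^ 2 := by
  intro h
  have hpA : ∀ i j, ⟪p i, A (p j)⟫ = T i j := by
    intro i j
    by_cases hj : j = Fin.last n
    · subst hj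
      simp [hlanlast, inner_add_right, inner_sum, real_inner_smul_right, horth, hg']
    · simp [hlan j hj, inner_sum, real_inner_smul_right, horth]
  have hpM : ∀ i j, ⟪p i, M (p j)⟫ = (1 : Matrix (Fin (n + 1)) (Fin (n + 1)) ℝ) i j :=
    fun i j => by rw [horth, one_apply]
  have hgx : ⟪g, ∑ j, h j • p j⟫ = γ₀ * h 0 := by
    simp [hg, inner_sum, real_inner_smul_left, real_inner_smul_right, hM, horth, mul_comm]
  rw [inner_sum_smul_apply_sum_smul A p T hpA, inner_sum_smul_apply_sum_smul M p 1 hpM, hgx]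
  exact ⟨rfl, by simp [dotProduct, sq]⟩
end

section
/- Let E be a real Hilbert space, A and M bounded self-adjoint operators on E, and let p₀,…,p_n ∈ E be M-orthonormal: ⟨p_j, M p_k⟩ = 1 if j = k and = 0 otherwise. Let T be a real symmetric (n+1)×(n+1) matrix, g' ∈ E with ⟨p_j, g'⟩ = 0 for all 0 ≤ j ≤ n, and suppose A p_j = Σ_{k=0}^{n} T(k,j) · M p_k for j < n and A p_n = Σ_{k=0}^{n} T(k,n) · M p_k + g'. Let γ₀ ∈ ℝ, g := γ₀ · M p₀, λ ∈ ℝ, and suppose h ∈ ℝ^{n+1} solves (T + λI)h = −γ₀ e₀. Then the point x := Σ_{j=0}^{n} h_j p_j satisfies (A + λM)x + g = h_n · g', i.e. the Lagrangian stationarity residual equals the last coordinate of h times the Lanczos residual vector g'. -/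
open Matrix RealInnerProductSpace

/-- Lagrangian stationarity residual in the Lanczos basis: if `h` solves the
tridiagonal system `(T + λI)h = -γ₀e₀`, then `x = Σ hⱼ pⱼ` satisfies
`(A + λM)x + g = h_n • g'`. -/
theorem lanczos_stationarity_residual
    {E : Type*} [NormedAddCommGroup E] [InnerProductSpace ℝ E] [CompleteSpace E]
    (A M : E →L[ℝ] E)
    (hA : ∀ x y : E, ⟪A x, y⟫ = ⟪x, A y⟫)
    (hM : ∀ x y : E, ⟪M x, y⟫ = ⟪x, M y⟫)
    {n : ℕ} (p : Fin (n + 1) → E)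
    (horth : ∀ j k : Fin (n + 1), ⟪p j, M (p k)⟫ = if j = k then 1 else 0)
    (T : Matrix (Fin (n + 1)) (Fin (n + 1)) ℝ) (hT : T.IsSymm)
    (g' : E) (hg' : ∀ j : Fin (n + 1), ⟪p j, g'⟫ = 0)
    (hlan : ∀ j : Fin (n + 1), j ≠ Fin.last n → A (p j) = ∑ k, T k j • M (p k))
    (hlanlast : A (p (Fin.last n)) = (∑ k, T k (Fin.last n) • M (p k)) + g')
    (γ₀ : ℝ) (g : E) (hg : g = γ₀ • M (p 0))
    (lam : ℝ)
    (e₀ : Fin (n + 1) → ℝ) (he₀ : e₀ = fun i => if i = 0 then 1 else 0)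
    (h : Fin (n + 1) → ℝ)
    (hsol : (T + lam • 1) *ᵥ h = -(γ₀ • e₀))
    (x : E) (hx : x = ∑ j, h j • p j) :
    A x + lam • M x + g = h (Fin.last n) • g' := by
  have hAp : ∀ j, A (p j) = (∑ k, T k j • M (p k)) + if j = Fin.last n then g' else 0 := by
    intro j
    by_cases hj : j = Fin.last n
    · subst hj
      simpa using hlanlast
    · simpa [hj] using hlan j hj
  have hAx : A x = (∑ k, (T *ᵥ h) k • M (p k)) + h (Fin.last n) • g' := by
    simp only [hx, map_sum, map_smul, hAp, smul_add, Finset.sum_add_distrib, Finset.smul_sum,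
      Matrix.mulVec, dotProduct, Finset.sum_smul, smul_ite, smul_zero, Finset.sum_ite_eq',
      Finset.mem_univ, if_true]
    rw [Finset.sum_comm]
    simp only [smul_smul, mul_comm]
  have hMx : lam • M x = ∑ k, (lam * h k) • M (p k) := by
    simp only [hx, map_sum, map_smul, Finset.smul_sum, smul_smul]
  have hgx : g = ∑ k, (γ₀ * e₀ k) • M (p k) := by
    simp [hg, he₀]
  have hcoord : ∀ k, (T *ᵥ h) k + lam * h k + γ₀ * e₀ k = 0 := by
    intro k
    have hk := congrFun hsol k
    simp only [Matrix.add_mulVec, Matrix.smul_mulVec, Matrix.one_mulVec, Pi.add_apply,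
      Pi.smul_apply, Pi.neg_apply, smul_eq_mul] at hk
    linarith
  have hsum : (∑ k, (T *ᵥ h) k • M (p k)) + (∑ k, (lam * h k) • M (p k)) +
      ∑ k, (γ₀ * e₀ k) • M (p k) = 0 := by
    simp only [← Finset.sum_add_distrib, ← add_smul, hcoord, zero_smul, Finset.sum_const_zero]
  rw [hAx, hMx, hgx, add_right_comm _ (h (Fin.last n) • g'),
    add_right_comm _ (h (Fin.last n) • g'), hsum, zero_add]
end
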